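/- arXiv:0712.0248 — 4 statements merged into one kernel-verified Lean document; each statement's English description precedes it below -/
import Mathlib

section
/- Let π be a probability measure on a measurable space Θ and h : Θ → ℝ a bounded measurable function. (i) For every probability measure ρ on Θ with K(ρ,π) < ∞, log π[exp(h)] = ρ(h) − K(ρ,π) + K(ρ, π_{exp(h)}). (ii) Consequently log π[exp(h)] = sup over probability measures ρ on Θ with K(ρ,π) < ∞ of ( ρ(h) − K(ρ,π) ). -/
open MeasureTheory

/-- Kullback–Leibler divergence `K(ρ,π) = ∫ log (dρ/dπ) dρ` (as a real number;
meaningful under `KLFin ρ π`). -/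
noncomputable def KL {Θ : Type*} [MeasurableSpace Θ] (ρ π : Measure Θ) : ℝ :=
  ∫ θ, Real.log ((ρ.rnDeriv π θ).toReal) ∂ρ

/-- Finiteness of the Kullback–Leibler divergence: `ρ ≪ π` and `log (dρ/dπ)`
is `ρ`-integrable. -/
def KLFin {Θ : Type*} [MeasurableSpace Θ] (ρ π : Measure Θ) : Prop :=
  ρ ≪ π ∧ Integrable (fun θ => Real.log ((ρ.rnDeriv π θ).toReal)) ρ

/-- The Gibbs measure `π_{exp h}` with density `exp h / π[exp h]` with respect to `π`. -/
noncomputable def Gibbs {Θ : Type*} [MeasurableSpace Θ] (π : Measure Θ) (h : Θ → ℝ) :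
    Measure Θ :=
  (ENNReal.ofReal (∫ θ, Real.exp (h θ) ∂π))⁻¹ •
    π.withDensity (fun θ => ENNReal.ofReal (Real.exp (h θ)))

theorem integrable_of_abs_le {Θ : Type*} [MeasurableSpace Θ] (μ : Measure Θ) [IsFiniteMeasure μ]
    {h : Θ → ℝ} (hmeas : Measurable h) {C : ℝ} (hbdd : ∀ θ, |h θ| ≤ C) : Integrable h μ :=
  .of_bound hmeas.aestronglyMeasurable C (.of_forall hbdd)

theorem integrable_exp_of_abs_le {Θ : Type*} [MeasurableSpace Θ] (μ : Measure Θ)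
    [IsFiniteMeasure μ] {h : Θ → ℝ} (hmeas : Measurable h) {C : ℝ} (hbdd : ∀ θ, |h θ| ≤ C) :
    Integrable (fun θ => Real.exp (h θ)) μ := by
  refine .of_bound hmeas.exp.aestronglyMeasurable (Real.exp C) (.of_forall fun θ => ?_)
  rw [Real.norm_eq_abs, Real.abs_exp]
  exact Real.exp_le_exp.2 ((le_abs_self _).trans (hbdd θ))

theorem Gibbs_eq_tilted {Θ : Type*} [MeasurableSpace Θ] (π : Measure Θ) [NeZero π]
    {h : Θ → ℝ} (hmeas : Measurable h) (hexp : Integrable (fun θ => Real.exp (h θ)) π) :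
    Gibbs π h = π.tilted h := by
  have hpos : 0 < ∫ θ, Real.exp (h θ) ∂π := integral_exp_pos hexp
  rw [Gibbs, Measure.tilted, ← withDensity_smul _ hmeas.exp.ennreal_ofReal]
  congr 1
  ext θ
  rw [Pi.smul_apply, smul_eq_mul, ENNReal.ofReal_div_of_pos hpos, ENNReal.div_eq_inv_mul]

theorem KLFin_tilted {Θ : Type*} [MeasurableSpace Θ] (π : Measure Θ) [IsProbabilityMeasure π]
    {h : Θ → ℝ} (hexp : Integrable (fun θ => Real.exp (h θ)) π)
    (hfint : Integrable h (π.tilted h)) : KLFin (π.tilted h) π := by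
  have := isProbabilityMeasure_tilted hexp
  refine ⟨tilted_absolutelyContinuous π h, ?_⟩
  refine (hfint.sub (integrable_const (Real.log (∫ θ, Real.exp (h θ) ∂π)))).congr ?_
  filter_upwards [(tilted_absolutelyContinuous π h).ae_le (log_rnDeriv_tilted_left_self hexp)]
    with θ hθ
  exact hθ.symm

theorem KL_self {Θ : Type*} [MeasurableSpace Θ] (μ : Measure Θ) [SigmaFinite μ] : KL μ μ = 0 :=
  integral_eq_zero_of_ae (llr_self μ)

theorem KL_nonneg {Θ : Type*} [MeasurableSpace Θ] {μ ν : Measure Θ} [IsProbabilityMeasure μ]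
    [IsProbabilityMeasure ν] (hfin : KLFin μ ν) : 0 ≤ KL μ ν := by
  have := InformationTheory.integral_llr_add_sub_measure_univ_nonneg hfin.1 hfin.2
  simpa [KL, llr_def] using this

/-- The Legendre transform identity for the log-Laplace transform:
(i) for every probability measure `ρ` with `K(ρ,π) < ∞`,
`log π[exp h] = ρ(h) - K(ρ,π) + K(ρ, π_{exp h})`; and consequently
(ii) `log π[exp h]` is the supremum of `ρ(h) - K(ρ,π)` over such `ρ`. -/
theorem statement_1 {Θ : Type*} [MeasurableSpace Θ] (π : Measure Θ) [IsProbabilityMeasure π]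
    (h : Θ → ℝ) (hmeas : Measurable h) (C : ℝ) (hbdd : ∀ θ, |h θ| ≤ C) :
    (∀ ρ : Measure Θ, IsProbabilityMeasure ρ → KLFin ρ π →
      Real.log (∫ θ, Real.exp (h θ) ∂π)
        = (∫ θ, h θ ∂ρ) - KL ρ π + KL ρ (Gibbs π h)) ∧
    sSup {x : ℝ | ∃ ρ : Measure Θ, IsProbabilityMeasure ρ ∧ KLFin ρ π ∧
        x = (∫ θ, h θ ∂ρ) - KL ρ π}
      = Real.log (∫ θ, Real.exp (h θ) ∂π) := by
  have hexp := integrable_exp_of_abs_le π hmeas hbdd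
  have := isProbabilityMeasure_tilted hexp
  rw [Gibbs_eq_tilted π hmeas hexp]
  have key : ∀ ρ : Measure Θ, IsProbabilityMeasure ρ → KLFin ρ π →
      Real.log (∫ θ, Real.exp (h θ) ∂π)
        = (∫ θ, h θ ∂ρ) - KL ρ π + KL ρ (π.tilted h) := by
    intro ρ _ hρ
    have hKL : KL ρ (π.tilted h)
        = KL ρ π - (∫ θ, h θ ∂ρ) + Real.log (∫ θ, Real.exp (h θ) ∂π) :=
      integral_llr_tilted_right hρ.1 (integrable_of_abs_le ρ hmeas hbdd) hexp hρ.2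
    rw [hKL]
    ring
  refine ⟨key, IsGreatest.csSup_eq ⟨⟨π.tilted h, this, ?_, ?_⟩, ?_⟩⟩
  · exact KLFin_tilted π hexp (integrable_of_abs_le _ hmeas hbdd)
  · rw [key _ this (KLFin_tilted π hexp (integrable_of_abs_le _ hmeas hbdd)), KL_self, add_zero]
  · rintro x ⟨ρ, hρ, hfin, rfl⟩
    rw [key ρ hρ hfin]
    exact le_add_of_nonneg_right (KL_nonneg
      ⟨hfin.1.trans (absolutelyContinuous_tilted hexp),
        integrable_llr_tilted_right hfin.1 (integrable_of_abs_le ρ hmeas hbdd) hfin.2 hexp⟩)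
end

section
/- Fix a probability measure π on Θ and a real constant λ. Then (i) ∫_Ω ∫_Θ exp( λ ( Φ_{λ/N}(R(θ)) − r(θ,ω) ) ) π(dθ) P(dω) ≤ 1; and (ii) for every posterior distribution ω ↦ ρ_ω with K(ρ_ω,π) < ∞ for P-almost every ω, P[ exp( λ Φ_{λ/N}( ρ_ω(R) ) − λ ρ_ω( r(·,ω) ) − K(ρ_ω, π) ) ] ≤ 1. -/
open MeasureTheory ProbabilityTheory

/-- `Φ_a(p) = -a⁻¹ log(1 - (1 - e^{-a}) p)` for `a ≠ 0`, and `Φ_0(p) = p`. -/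
noncomputable def Phi (a p : ℝ) : ℝ :=
  if a = 0 then p else -a⁻¹ * Real.log (1 - (1 - Real.exp (-a)) * p)

/-- `Φ_a⁻¹(q) = (1 - e^{-aq})/(1 - e^{-a})` for `a ≠ 0`, and `Φ_0⁻¹(q) = q`. -/
noncomputable def PhiInv (a q : ℝ) : ℝ :=
  if a = 0 then q else (1 - Real.exp (-(a * q))) / (1 - Real.exp (-a))

/-- Empirical error rate `r(θ,ω) = N⁻¹ ∑ᵢ 1[f_θ(X_i) ≠ Y_i]`. -/
noncomputable def empErr {𝒳 𝒴 Θ : Type*} [DecidableEq 𝒴] (N : ℕ)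
    (f : Θ → 𝒳 → 𝒴) (θ : Θ) (ω : Fin N → 𝒳 × 𝒴) : ℝ :=
  (N : ℝ)⁻¹ * ∑ i, if f θ (ω i).1 = (ω i).2 then 0 else 1

/-- Expected error rate `R(θ) = N⁻¹ ∑ᵢ P[f_θ(X_i) ≠ Y_i]`. -/
noncomputable def expErr {𝒳 𝒴 Θ : Type*} [MeasurableSpace 𝒳] [MeasurableSpace 𝒴] (N : ℕ)
    (P : Measure (Fin N → 𝒳 × 𝒴)) (f : Θ → 𝒳 → 𝒴) (θ : Θ) : ℝ :=
  (N : ℝ)⁻¹ * ∑ i, (P {ω | f θ (ω i).1 ≠ (ω i).2}).toReal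

/-- The affine function `p ↦ 1 - (1 - e^{-a}) p` takes values in `[e^{-|a|}, e^{|a|}]`
on `[0, 1]`. -/
lemma one_sub_one_sub_exp_mul_mem_Icc (a : ℝ) {p : ℝ} (hp : p ∈ Set.Icc (0 : ℝ) 1) :
    1 - (1 - Real.exp (-a)) * p ∈ Set.Icc (Real.exp (-|a|)) (Real.exp |a|) := by
  obtain ⟨h0, h1⟩ := hp
  have e1 : Real.exp (-|a|) ≤ Real.exp (-a) := Real.exp_le_exp.2 (neg_le_neg (le_abs_self a))
  have e2 : Real.exp (-a) ≤ Real.exp |a| := Real.exp_le_exp.2 (neg_le_abs a)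
  have e3 : Real.exp (-|a|) ≤ 1 := Real.exp_le_one_iff.2 (by simp)
  have e4 : 1 ≤ Real.exp |a| := Real.one_le_exp (abs_nonneg a)
  constructor <;> nlinarith

lemma abs_log_one_sub_one_sub_exp_mul_le (a : ℝ) {p : ℝ} (hp : p ∈ Set.Icc (0 : ℝ) 1) :
    |Real.log (1 - (1 - Real.exp (-a)) * p)| ≤ |a| := by
  obtain ⟨h0, h1⟩ := one_sub_one_sub_exp_mul_mem_Icc a hp
  have hpos := (Real.exp_pos _).trans_le h0
  exact abs_le.2 ⟨(Real.le_log_iff_exp_le hpos).2 h0, (Real.log_le_iff_le_exp hpos).2 h1⟩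

lemma mul_Phi_div {N : ℕ} (hN : 0 < N) (lam p : ℝ) :
    lam * Phi (lam / N) p = -N * Real.log (1 - (1 - Real.exp (-(lam / N))) * p) := by
  have hN' : (N : ℝ) ≠ 0 := by positivity
  rcases eq_or_ne lam 0 with rfl | h
  · simp
  · rw [Phi, if_neg (div_ne_zero h hN')]
    field_simp

/-- **AM-GM** in product form: if the `z i` average to `m`, then `∏ z i ≤ m ^ n`. -/
lemma prod_le_pow_of_sum_eq {n : ℕ} {z : Fin n → ℝ} {m : ℝ} (hz : ∀ i, 0 ≤ z i) (hm : 0 < m)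
    (hsum : ∑ i, z i = n * m) : ∏ i, z i ≤ m ^ n := by
  have h : ∏ i, z i / m ≤ ∏ i, Real.exp (z i / m - 1) :=
    Finset.prod_le_prod (fun i _ => div_nonneg (hz i) hm.le)
      fun i _ => by linarith [Real.add_one_le_exp (z i / m - 1)]
  rw [← Real.exp_sum, Finset.sum_sub_distrib, ← Finset.sum_div, hsum, Finset.prod_div_distrib]
    at h
  simpa [hm.ne', div_le_iff₀ (pow_pos hm n)] using h

/-- The upper bound in the **Donsker–Varadhan variational formula**. -/
lemma exp_integral_sub_KL_le {Θ : Type*} [MeasurableSpace Θ] {ρ π : Measure Θ}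
    [IsProbabilityMeasure ρ] [IsProbabilityMeasure π] (hKL : KLFin ρ π) {h : Θ → ℝ}
    (hρ : Integrable h ρ) (hπ : Integrable (fun θ => Real.exp (h θ)) π) :
    Real.exp (∫ θ, h θ ∂ρ - KL ρ π) ≤ ∫ θ, Real.exp (h θ) ∂π := by
  have := isProbabilityMeasure_tilted hπ
  have hpos : 0 < ∫ θ, Real.exp (h θ) ∂π := integral_exp_pos hπ
  have hInt := integral_llr_tilted_right hKL.1 hρ hπ hKL.2
  rw [← InformationTheory.toReal_klDiv_of_measure_eq
    (hKL.1.trans (absolutelyContinuous_tilted hπ)) (by simp)] at hInt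
  rw [← Real.le_log_iff_exp_le hpos]
  have hnn : 0 ≤ (InformationTheory.klDiv ρ (π.tilted h)).toReal := ENNReal.toReal_nonneg
  change _ = KL ρ π - _ + _ at hInt
  linarith

lemma inv_mul_sum_mem_Icc {N : ℕ} (hN : 0 < N) {z : Fin N → ℝ}
    (hz : ∀ i, z i ∈ Set.Icc (0 : ℝ) 1) : (N : ℝ)⁻¹ * ∑ i, z i ∈ Set.Icc (0 : ℝ) 1 := by
  refine ⟨mul_nonneg (by positivity) (Finset.sum_nonneg fun i _ => (hz i).1), ?_⟩
  rw [inv_mul_le_iff₀ (by positivity)]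
  simpa using Finset.sum_le_sum fun i (_ : i ∈ Finset.univ) => (hz i).2

section ErrorRates

variable {𝒳 𝒴 Θ : Type*} {N : ℕ} {f : Θ → 𝒳 → 𝒴}

lemma empErr_mem_Icc [DecidableEq 𝒴] (hN : 0 < N) (θ : Θ) (ω : Fin N → 𝒳 × 𝒴) :
    empErr N f θ ω ∈ Set.Icc (0 : ℝ) 1 :=
  inv_mul_sum_mem_Icc hN fun i => by split_ifs <;> simp

lemma abs_mul_empErr_le [DecidableEq 𝒴] (hN : 0 < N) (lam : ℝ) (θ : Θ)
    (ω : Fin N → 𝒳 × 𝒴) : |lam * empErr N f θ ω| ≤ |lam| := by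
  have h := empErr_mem_Icc (f := f) hN θ ω
  rw [abs_mul, abs_of_nonneg h.1]
  exact mul_le_of_le_one_right (abs_nonneg _) h.2

variable [MeasurableSpace 𝒳] [MeasurableSpace 𝒴]

lemma expErr_mem_Icc (hN : 0 < N) (P : Measure (Fin N → 𝒳 × 𝒴)) [IsProbabilityMeasure P]
    (θ : Θ) : expErr N P f θ ∈ Set.Icc (0 : ℝ) 1 :=
  inv_mul_sum_mem_Icc hN fun _ => ⟨measureReal_nonneg, measureReal_le_one⟩

lemma abs_mul_Phi_expErr_le (hN : 0 < N)
    (P : Measure (Fin N → 𝒳 × 𝒴)) [IsProbabilityMeasure P] (lam : ℝ) (θ : Θ) :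
    |lam * Phi (lam / N) (expErr N P f θ)| ≤ |lam| := by
  have hN' : (0 : ℝ) < N := by positivity
  have h := abs_log_one_sub_one_sub_exp_mul_le (lam / N) (expErr_mem_Icc (f := f) hN P θ)
  rw [mul_Phi_div hN, abs_mul, abs_neg, Nat.abs_cast]
  rwa [abs_div, Nat.abs_cast, le_div_iff₀' hN'] at h

lemma abs_mul_Phi_expErr_sub_empErr_le [DecidableEq 𝒴] (hN : 0 < N)
    (P : Measure (Fin N → 𝒳 × 𝒴)) [IsProbabilityMeasure P] (lam : ℝ) (θ : Θ)
    (ω : Fin N → 𝒳 × 𝒴) :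
    |lam * (Phi (lam / N) (expErr N P f θ) - empErr N f θ ω)| ≤ 2 * |lam| := by
  rw [mul_sub, two_mul]
  exact (abs_sub _ _).trans
    (add_le_add (abs_mul_Phi_expErr_le hN P lam θ) (abs_mul_empErr_le hN lam θ ω))

variable [MeasurableSpace Θ]

lemma measurableSet_correct [MeasurableEq 𝒴] (hf : Measurable fun p : Θ × 𝒳 => f p.1 p.2)
    (i : Fin N) :
    MeasurableSet {q : Θ × (Fin N → 𝒳 × 𝒴) | f q.1 (q.2 i).1 = (q.2 i).2} :=
  measurableSet_eq_fun (hf.comp (f := fun q : Θ × (Fin N → 𝒳 × 𝒴) => (q.1, (q.2 i).1))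
    (by fun_prop)) (by fun_prop)

lemma measurable_empErr [DecidableEq 𝒴] [MeasurableEq 𝒴]
    (hf : Measurable fun p : Θ × 𝒳 => f p.1 p.2) :
    Measurable fun q : Θ × (Fin N → 𝒳 × 𝒴) => empErr N f q.1 q.2 := by
  unfold empErr
  exact (Finset.measurable_sum _ fun i _ => Measurable.ite (measurableSet_correct hf i)
    measurable_const measurable_const).const_mul _

lemma measurable_expErr [MeasurableEq 𝒴] (hf : Measurable fun p : Θ × 𝒳 => f p.1 p.2)
    (P : Measure (Fin N → 𝒳 × 𝒴)) [SFinite P] : Measurable (expErr N P f) := by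
  unfold expErr
  exact (Finset.measurable_sum _ fun i _ =>
    (measurable_measure_prodMk_left (measurableSet_correct hf i).compl).ennreal_toReal).const_mul _

lemma measurable_mul_Phi_expErr_sub_empErr [DecidableEq 𝒴] [MeasurableEq 𝒴]
    (hf : Measurable fun p : Θ × 𝒳 => f p.1 p.2) (hN : 0 < N)
    (P : Measure (Fin N → 𝒳 × 𝒴)) [SFinite P] (lam : ℝ) :
    Measurable fun q : Θ × (Fin N → 𝒳 × 𝒴) =>
      lam * (Phi (lam / N) (expErr N P f q.1) - empErr N f q.1 q.2) := by
  simp only [mul_sub, mul_Phi_div hN]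
  have h1 : Measurable fun q : Θ × (Fin N → 𝒳 × 𝒴) => expErr N P f q.1 :=
    (measurable_expErr hf P).comp measurable_fst
  exact (((h1.const_mul _).const_sub _).log.const_mul _).sub
    ((measurable_empErr hf).const_mul lam)

/-- The exponential moment of the empirical error rate of a fixed parameter. -/
lemma integral_exp_mul_Phi_expErr_sub_empErr_le_one [DecidableEq 𝒴] [MeasurableEq 𝒴]
    (hf : Measurable fun p : Θ × 𝒳 => f p.1 p.2) (hN : 0 < N)
    (Ps : Fin N → Measure (𝒳 × 𝒴)) [∀ i, IsProbabilityMeasure (Ps i)] (lam : ℝ) (θ : Θ) :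
    ∫ ω, Real.exp (lam * (Phi (lam / N) (expErr N (Measure.pi Ps) f θ) - empErr N f θ ω))
      ∂Measure.pi Ps ≤ 1 := by
  have hN' : (N : ℝ) ≠ 0 := by positivity
  set c := 1 - Real.exp (-(lam / N)) with hc
  set R := expErr N (Measure.pi Ps) f θ with hR
  have hm : 0 < 1 - c * R :=
    (Real.exp_pos _).trans_le (one_sub_one_sub_exp_mul_mem_Icc _ (expErr_mem_Icc hN _ θ)).1
  have hA : MeasurableSet {x : 𝒳 × 𝒴 | f θ x.1 ≠ x.2} :=
    (measurableSet_eq_fun (hf.comp (f := fun x : 𝒳 × 𝒴 => (θ, x.1)) (by fun_prop))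
      (by fun_prop)).compl
  have hind : ∀ x : 𝒳 × 𝒴, Real.exp (-(lam / N) * if f θ x.1 = x.2 then 0 else 1)
      = 1 - c * {x : 𝒳 × 𝒴 | f θ x.1 ≠ x.2}.indicator 1 x := by
    intro x
    by_cases hx : f θ x.1 = x.2 <;> simp [hx, hc]
  have hfac : ∀ ω : Fin N → 𝒳 × 𝒴, Real.exp (-(lam * empErr N f θ ω))
      = ∏ i, (1 - c * {x : 𝒳 × 𝒴 | f θ x.1 ≠ x.2}.indicator 1 (ω i)) := by
    intro ω
    simp_rw [← hind, ← Real.exp_sum, ← Finset.mul_sum]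
    rw [empErr]
    ring_nf
  have hone : ∀ i, ∫ x, (1 - c * {x : 𝒳 × 𝒴 | f θ x.1 ≠ x.2}.indicator 1 x) ∂Ps i
      = 1 - c * (Ps i).real {x | f θ x.1 ≠ x.2} := by
    intro i
    have hInt : Integrable ({x : 𝒳 × 𝒴 | f θ x.1 ≠ x.2}.indicator (1 : 𝒳 × 𝒴 → ℝ)) (Ps i) :=
      (integrable_const (1 : ℝ)).indicator hA
    rw [integral_sub (integrable_const _) (hInt.const_mul c), integral_const_mul,
      integral_indicator_one hA]
    simp
  have hmarg : R = (N : ℝ)⁻¹ * ∑ i, (Ps i).real {x | f θ x.1 ≠ x.2} := by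
    rw [hR, expErr]
    congr 1
    refine Finset.sum_congr rfl fun i _ => ?_
    rw [measureReal_def, ← (measurePreserving_eval Ps i).measure_preimage hA.nullMeasurableSet]
    rfl
  have hprod : ∏ i, (1 - c * (Ps i).real {x | f θ x.1 ≠ x.2}) ≤ (1 - c * R) ^ N := by
    refine prod_le_pow_of_sum_eq (fun i => ?_) hm ?_
    · exact (Real.exp_pos _).le.trans
        (one_sub_one_sub_exp_mul_mem_Icc _ ⟨measureReal_nonneg, measureReal_le_one⟩).1
    · rw [hmarg, Finset.sum_sub_distrib, ← Finset.mul_sum]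
      simp
      field_simp
  have hΦ : Real.exp (lam * Phi (lam / N) R) = ((1 - c * R) ^ N)⁻¹ := by
    rw [mul_Phi_div hN, neg_mul, Real.exp_neg, Real.exp_nat_mul, Real.exp_log hm]
  simp_rw [mul_sub, sub_eq_add_neg, Real.exp_add, integral_const_mul, hfac]
  rw [integral_fintype_prod_eq_prod
    (fun _ x => 1 - c * {x : 𝒳 × 𝒴 | f θ x.1 ≠ x.2}.indicator 1 x), hΦ,
    inv_mul_le_iff₀ (pow_pos hm N), mul_one]
  simpa only [hone] using hprod

/-- **Jensen's inequality** for the convex function `λ Φ_{λ/N}`. -/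
lemma mul_Phi_integral_expErr_le [MeasurableEq 𝒴]
    (hf : Measurable fun p : Θ × 𝒳 => f p.1 p.2) (hN : 0 < N)
    (P : Measure (Fin N → 𝒳 × 𝒴)) [IsProbabilityMeasure P] (lam : ℝ)
    (ρ : Measure Θ) [IsProbabilityMeasure ρ] :
    lam * Phi (lam / N) (∫ θ, expErr N P f θ ∂ρ)
      ≤ ∫ θ, lam * Phi (lam / N) (expErr N P f θ) ∂ρ := by
  have hmeas := measurable_expErr hf P
  have hR : Integrable (expErr N P f) ρ := by
    refine .of_bound hmeas.aestronglyMeasurable 1 (.of_forall fun θ => ?_)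
    have h := expErr_mem_Icc (f := f) hN P θ
    rw [Real.norm_eq_abs, abs_of_nonneg h.1]
    exact h.2
  simp only [mul_Phi_div hN, neg_mul, integral_neg, integral_const_mul]
  refine neg_le_neg (mul_le_mul_of_nonneg_left ?_ (Nat.cast_nonneg N))
  set c := 1 - Real.exp (-(lam / N)) with hc
  have hsub : Set.Icc (Real.exp (-|lam / N|)) (Real.exp |lam / N|) ⊆ Set.Ioi 0 :=
    fun x hx => (Real.exp_pos _).trans_le hx.1
  have hInt : ∫ θ, (1 - c * expErr N P f θ) ∂ρ = 1 - c * ∫ θ, expErr N P f θ ∂ρ := by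
    rw [integral_sub (integrable_const _) (hR.const_mul c), integral_const_mul]
    simp
  rw [← hInt]
  refine ConcaveOn.le_map_integral
    (strictConcaveOn_log_Ioi.concaveOn.subset hsub (convex_Icc _ _))
    (Real.continuousOn_log.mono fun x hx => (hsub hx).ne') isClosed_Icc
    (.of_forall fun θ => one_sub_one_sub_exp_mul_mem_Icc _ (expErr_mem_Icc hN P θ))
    ((integrable_const _).sub (hR.const_mul c)) ?_
  exact .of_bound (((hmeas.const_mul c).const_sub 1).log.aestronglyMeasurable) |lam / N|
    (.of_forall fun θ => abs_log_one_sub_one_sub_exp_mul_le _ (expErr_mem_Icc hN P θ))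

/-- The change of measure inequality for a fixed sample. -/
lemma exp_mul_Phi_integral_sub_KL_le [DecidableEq 𝒴] [MeasurableEq 𝒴]
    (hf : Measurable fun p : Θ × 𝒳 => f p.1 p.2) (hN : 0 < N)
    (P : Measure (Fin N → 𝒳 × 𝒴)) [IsProbabilityMeasure P]
    {ρ π : Measure Θ} [IsProbabilityMeasure ρ] [IsProbabilityMeasure π] (hKL : KLFin ρ π)
    (lam : ℝ) (ω : Fin N → 𝒳 × 𝒴) :
    Real.exp (lam * Phi (lam / N) (∫ θ, expErr N P f θ ∂ρ)
        - lam * (∫ θ, empErr N f θ ω ∂ρ) - KL ρ π)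
      ≤ ∫ θ, Real.exp (lam * (Phi (lam / N) (expErr N P f θ) - empErr N f θ ω)) ∂π := by
  have hGb := abs_mul_Phi_expErr_sub_empErr_le (f := f) hN P lam
  have hpair : Measurable fun θ : Θ => (θ, ω) := measurable_id.prodMk measurable_const
  have hGω : Measurable fun θ => lam * (Phi (lam / N) (expErr N P f θ) - empErr N f θ ω) := by
    simpa only [Function.comp_def] using
      (measurable_mul_Phi_expErr_sub_empErr hf hN P lam).comp hpair
  have hemp : Measurable fun θ => lam * empErr N f θ ω := by
    simpa only [Function.comp_def] using ((measurable_empErr hf).comp hpair).const_mul lam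
  have hintG : Integrable
      (fun θ => lam * (Phi (lam / N) (expErr N P f θ) - empErr N f θ ω)) ρ :=
    .of_bound hGω.aestronglyMeasurable (2 * |lam|) (.of_forall fun θ => hGb θ ω)
  have hintemp : Integrable (fun θ => lam * empErr N f θ ω) ρ :=
    .of_bound hemp.aestronglyMeasurable |lam| (.of_forall fun θ => abs_mul_empErr_le hN lam θ ω)
  have hintexp : Integrable (fun θ => Real.exp
      (lam * (Phi (lam / N) (expErr N P f θ) - empErr N f θ ω))) π := by
    refine .of_bound hGω.exp.aestronglyMeasurable (Real.exp (2 * |lam|)) (.of_forall fun θ => ?_)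
    rw [Real.norm_eq_abs, Real.abs_exp, Real.exp_le_exp]
    exact (le_abs_self _).trans (hGb θ ω)
  refine le_trans (Real.exp_le_exp.2 ?_) (exp_integral_sub_KL_le hKL hintG hintexp)
  have hsplit : ∫ θ, lam * (Phi (lam / N) (expErr N P f θ) - empErr N f θ ω) ∂ρ
      = ∫ θ, lam * Phi (lam / N) (expErr N P f θ) ∂ρ - lam * ∫ θ, empErr N f θ ω ∂ρ := by
    rw [eq_sub_iff_add_eq, ← integral_const_mul, ← integral_add hintG hintemp]
    simp_rw [mul_sub, sub_add_cancel]
  rw [hsplit]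
  linarith [mul_Phi_integral_expErr_le hf hN P lam ρ]

end ErrorRates

/-- PAC-Bayes basic exponential inequality (Theorem 1.4/`thm2.3` of Catoni):
(i) `∫∫ exp(λ(Φ_{λ/N}(R(θ)) - r(θ,ω))) dπ dP ≤ 1`, and
(ii) for every posterior (Markov kernel) `ρ` with `K(ρ_ω,π) < ∞` for `P`-a.e. `ω`,
`P[exp(λ Φ_{λ/N}(ρ_ω(R)) - λ ρ_ω(r(·,ω)) - K(ρ_ω,π))] ≤ 1`. -/
theorem statement_2 {𝒳 𝒴 Θ : Type*} [MeasurableSpace 𝒳] [MeasurableSpace 𝒴]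
    [Fintype 𝒴] [DecidableEq 𝒴] [MeasurableSingletonClass 𝒴] [MeasurableSpace Θ]
    (N : ℕ) (hN : 0 < N)
    (Ps : Fin N → Measure (𝒳 × 𝒴)) [∀ i, IsProbabilityMeasure (Ps i)]
    (P : Measure (Fin N → 𝒳 × 𝒴)) [IsProbabilityMeasure P] (hP : P = Measure.pi Ps)
    (f : Θ → 𝒳 → 𝒴) (hf : Measurable fun p : Θ × 𝒳 => f p.1 p.2)
    (π : Measure Θ) [IsProbabilityMeasure π] (lam : ℝ)
    (ρ : Kernel (Fin N → 𝒳 × 𝒴) Θ) [IsMarkovKernel ρ]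
    (hρ : ∀ᵐ ω ∂P, KLFin (ρ ω) π) :
    (∫ ω, (∫ θ, Real.exp (lam * (Phi (lam / N) (expErr N P f θ) - empErr N f θ ω)) ∂π) ∂P
        ≤ 1)
    ∧ (∫ ω, Real.exp (lam * Phi (lam / N) (∫ θ, expErr N P f θ ∂(ρ ω))
          - lam * (∫ θ, empErr N f θ ω ∂(ρ ω)) - KL (ρ ω) π) ∂P ≤ 1) := by
  have hG := measurable_mul_Phi_expErr_sub_empErr hf hN P lam
  have hGb := abs_mul_Phi_expErr_sub_empErr_le (f := f) hN P lam
  have hInt : Integrable (fun q : Θ × (Fin N → 𝒳 × 𝒴) =>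
      Real.exp (lam * (Phi (lam / N) (expErr N P f q.1) - empErr N f q.1 q.2))) (π.prod P) := by
    refine .of_bound hG.exp.aestronglyMeasurable (Real.exp (2 * |lam|)) (.of_forall fun q => ?_)
    rw [Real.norm_eq_abs, Real.abs_exp, Real.exp_le_exp]
    exact (le_abs_self _).trans (hGb q.1 q.2)
  have hfirst : ∫ ω, (∫ θ, Real.exp (lam * (Phi (lam / N) (expErr N P f θ)
      - empErr N f θ ω)) ∂π) ∂P ≤ 1 := by
    rw [← integral_integral_swap hInt]
    subst hP
    calc _ ≤ ∫ _, (1 : ℝ) ∂π :=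
          integral_mono hInt.integral_prod_left (integrable_const _)
            fun θ => integral_exp_mul_Phi_expErr_sub_empErr_le_one hf hN Ps lam θ
      _ = 1 := by simp
  refine ⟨hfirst, le_trans ?_ hfirst⟩
  have hIntω := hInt.integral_prod_right
  refine integral_mono_of_nonneg (.of_forall fun ω => (Real.exp_pos _).le) hIntω ?_
  filter_upwards [hρ] with ω hω
  exact exp_mul_Phi_integral_sub_KL_le hf hN P hω lam ω
end

section
/- Let π be a probability measure on a measurable space Θ and R : Θ → [0,1] a measurable function, and let m = ess inf_π R be the essential infimum of R under π. Then for every η ≥ 0 and every β ≥ 0, β ( π_{exp(−βR)}(R) − m − η ) ≤ −log π( { θ : R(θ) ≤ m + η } ), where the right-hand side is interpreted as +∞ if π({R ≤ m + η}) = 0 (for η > 0 this probability is positive). -/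
open MeasureTheory
open scoped Classical

/-- Expectations under the Gibbs measure are normalized weighted integrals. -/
theorem integral_gibbs {Θ : Type*} [MeasurableSpace Θ] (π : Measure Θ) {h : Θ → ℝ}
    (hh : Measurable h) (g : Θ → ℝ) :
    ∫ θ, g θ ∂(Gibbs π h) = (∫ θ, Real.exp (h θ) ∂π)⁻¹ * ∫ θ, Real.exp (h θ) * g θ ∂π := by
  have hZ : 0 ≤ ∫ θ, Real.exp (h θ) ∂π := integral_nonneg fun θ => (Real.exp_pos _).le
  rw [Gibbs, integral_smul_measure, ENNReal.toReal_inv, ENNReal.toReal_ofReal hZ,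
    integral_withDensity_eq_integral_toReal_smul (by fun_prop) (by simp)]
  simp [ENNReal.toReal_ofReal (Real.exp_pos _).le]

/-- Nonnegativity of the relative entropy of the Gibbs measure: the Gibbs expectation of `h`
is at least the log-partition function. -/
theorem log_integral_exp_le_integral_gibbs {Θ : Type*} [MeasurableSpace Θ] (π : Measure Θ)
    [IsProbabilityMeasure π] {h : Θ → ℝ} (hh : Measurable h)
    (hexp : Integrable (fun θ => Real.exp (h θ)) π)
    (hexp_mul : Integrable (fun θ => Real.exp (h θ) * h θ) π) :
    Real.log (∫ θ, Real.exp (h θ) ∂π) ≤ ∫ θ, h θ ∂(Gibbs π h) := by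
  have hZ : 0 < ∫ θ, Real.exp (h θ) ∂π := integral_exp_pos hexp
  rw [integral_gibbs π hh, le_inv_mul_iff₀ hZ]
  set Z := ∫ θ, Real.exp (h θ) ∂π with hZdef
  have hpt : ∀ θ, Real.exp (h θ) * (1 + Real.log Z) - Z ≤ Real.exp (h θ) * h θ := fun θ => by
    have h1 := mul_le_mul_of_nonneg_left (Real.add_one_le_exp (Real.log Z - h θ))
      (Real.exp_pos (h θ)).le
    rw [← Real.exp_add, add_sub_cancel, Real.exp_log hZ] at h1
    linarith
  have hint := integral_mono ((hexp.mul_const (1 + Real.log Z)).sub (integrable_const Z))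
    hexp_mul hpt
  simp only [Pi.sub_apply] at hint
  rw [integral_sub (hexp.mul_const _) (integrable_const Z), integral_mul_const, ← hZdef,
    integral_const, probReal_univ, one_smul] at hint
  linarith

/-- With `m = ess inf_π R`: for every `η ≥ 0` and `β ≥ 0`,
`β (π_{exp(-βR)}(R) - m - η) ≤ -log π({R ≤ m + η})`, the right-hand side being `+∞`
when `π({R ≤ m + η}) = 0`; moreover for `η > 0` this probability is positive. -/
theorem statement_7 {Θ : Type*} [MeasurableSpace Θ] (π : Measure Θ) [IsProbabilityMeasure π]
    (R : Θ → ℝ) (hR : Measurable R) (hR01 : ∀ θ, R θ ∈ Set.Icc (0 : ℝ) 1)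
    (η β : ℝ) (hη : 0 ≤ η) (hβ : 0 ≤ β) :
    (((β * ((∫ θ, R θ ∂(Gibbs π (fun θ => -(β * R θ)))) - essInf R π - η) : ℝ) : EReal)
        ≤ if π {θ | R θ ≤ essInf R π + η} = 0 then (⊤ : EReal)
          else ((-Real.log ((π {θ | R θ ≤ essInf R π + η}).toReal) : ℝ) : EReal))
    ∧ (0 < η → π {θ | R θ ≤ essInf R π + η} ≠ 0) := by
  have hm : Measurable fun θ => -(β * R θ) := by fun_prop
  have hle : ∀ θ, -(β * R θ) ≤ 0 := fun θ => neg_nonpos.2 (mul_nonneg hβ (hR01 θ).1)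
  have hexp : Integrable (fun θ => Real.exp (-(β * R θ))) π :=
    Integrable.of_bound (by fun_prop) 1 (.of_forall fun θ => by simpa using hle θ)
  have hexp_mul : Integrable (fun θ => Real.exp (-(β * R θ)) * -(β * R θ)) π := by
    refine hexp.mul_bdd (c := β) (by fun_prop) (.of_forall fun θ => ?_)
    rw [norm_neg, Real.norm_of_nonneg (mul_nonneg hβ (hR01 θ).1)]
    exact mul_le_of_le_one_right hβ (hR01 θ).2
  refine ⟨?_, fun hpos hnull => ?_⟩
  · split_ifs with h0
    · exact le_top
    rw [EReal.coe_le_coe_iff]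
    set c := essInf R π + η with hc
    have hS : MeasurableSet {θ | R θ ≤ c} := measurableSet_le hR measurable_const
    have hp : 0 < π.real {θ | R θ ≤ c} := ENNReal.toReal_pos h0 (measure_ne_top _ _)
    have hlow : π.real {θ | R θ ≤ c} * Real.exp (-(β * c)) ≤ ∫ θ, Real.exp (-(β * R θ)) ∂π := by
      calc π.real {θ | R θ ≤ c} * Real.exp (-(β * c))
          = ∫ _ in {θ | R θ ≤ c}, Real.exp (-(β * c)) ∂π := by simp
        _ ≤ ∫ θ in {θ | R θ ≤ c}, Real.exp (-(β * R θ)) ∂π :=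
            setIntegral_mono_on (integrable_const _) hexp.integrableOn hS fun θ hθ =>
              Real.exp_le_exp.2 (neg_le_neg (mul_le_mul_of_nonneg_left hθ hβ))
        _ ≤ ∫ θ, Real.exp (-(β * R θ)) ∂π :=
            setIntegral_le_integral hexp (.of_forall fun θ => (Real.exp_pos _).le)
    have hlog := Real.log_le_log (mul_pos hp (Real.exp_pos _)) hlow
    rw [Real.log_mul hp.ne' (Real.exp_pos _).ne', Real.log_exp] at hlog
    have hent := log_integral_exp_le_integral_gibbs π hm hexp hexp_mul
    rw [integral_neg, integral_const_mul] at hent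
    change _ ≤ -Real.log (π.real {θ | R θ ≤ c})
    rw [sub_sub, ← hc, mul_sub]
    linarith
  · have hae : ∀ᵐ θ ∂π, essInf R π + η ≤ R θ := by
      rw [← compl_mem_ae_iff] at hnull
      filter_upwards [hnull] with θ hθ
      exact le_of_not_ge hθ
    have hcobdd : Filter.IsCoboundedUnder (· ≥ ·) (ae π) R :=
      (Filter.isBoundedUnder_of ⟨1, fun θ => (hR01 θ).2⟩).isCoboundedUnder_ge
    have := Filter.le_liminf_of_le hcobdd hae
    change _ ≤ essInf R π at this
    linarith
end

section
/- Let π be a probability measure on a measurable space Θ and let g, h : Θ → ℝ be bounded measurable functions. Then π_{exp(−g)}(g) − π_{exp(−h)}(g) ≤ π_{exp(−g)}(h) − π_{exp(−h)}(h). -/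
open MeasureTheory

/-- Integration against a Gibbs measure, with the density written as a single exponential. -/
theorem integral_Gibbs {Θ : Type*} [MeasurableSpace Θ] (π : Measure Θ) [NeZero π]
    {k : Θ → ℝ} (hk : Measurable k) (hint : Integrable (fun θ => Real.exp (k θ)) π)
    (f : Θ → ℝ) :
    ∫ θ, f θ ∂(Gibbs π k) =
      ∫ θ, Real.exp (k θ - Real.log (∫ ω, Real.exp (k ω) ∂π)) * f θ ∂π := by
  have hZ : 0 < ∫ θ, Real.exp (k θ) ∂π := integral_exp_pos hint
  rw [Gibbs, integral_smul_measure, integral_withDensity_eq_integral_toReal_smul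
    (by fun_prop) (by simp), ENNReal.toReal_inv, ENNReal.toReal_ofReal hZ.le, smul_eq_mul,
    ← integral_const_mul]
  refine integral_congr_ae (.of_forall fun θ => ?_)
  simp only [smul_eq_mul, ENNReal.toReal_ofReal (Real.exp_pos _).le, Real.exp_sub,
    Real.exp_log hZ]
  ring

theorem integral_exp_sub_log_integral {Θ : Type*} [MeasurableSpace Θ] (π : Measure Θ) [NeZero π]
    {k : Θ → ℝ} (hint : Integrable (fun θ => Real.exp (k θ)) π) :
    ∫ θ, Real.exp (k θ - Real.log (∫ ω, Real.exp (k ω) ∂π)) ∂π = 1 := by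
  have hZ : 0 < ∫ θ, Real.exp (k θ) ∂π := integral_exp_pos hint
  simp only [Real.exp_sub, Real.exp_log hZ, integral_div, div_self hZ.ne']

theorem exp_sub_exp_mul_sub_nonneg (a b : ℝ) : 0 ≤ (Real.exp a - Real.exp b) * (a - b) := by
  rcases le_total a b with hab | hab
  · exact mul_nonneg_of_nonpos_of_nonpos (sub_nonpos.2 (Real.exp_le_exp.2 hab))
      (sub_nonpos.2 hab)
  · exact mul_nonneg (sub_nonneg.2 (Real.exp_le_exp.2 hab)) (sub_nonneg.2 hab)

theorem integrable_exp_neg_sub_const {Θ : Type*} [MeasurableSpace Θ] (π : Measure Θ)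
    [IsFiniteMeasure π] {k : Θ → ℝ} (hk : Measurable k) {C : ℝ} (hC : ∀ θ, |k θ| ≤ C) (z : ℝ) :
    Integrable (fun θ => Real.exp (-k θ - z)) π := by
  refine Integrable.of_bound (C := Real.exp (C - z)) (by fun_prop) (.of_forall fun θ => ?_)
  rw [Real.norm_eq_abs, Real.abs_exp]
  gcongr
  exact (neg_le_abs _).trans (hC θ)

/-- For bounded measurable `g, h`:
`π_{exp(-g)}(g) - π_{exp(-h)}(g) ≤ π_{exp(-g)}(h) - π_{exp(-h)}(h)`. -/
theorem statement_11 {Θ : Type*} [MeasurableSpace Θ] (π : Measure Θ) [IsProbabilityMeasure π]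
    (g h : Θ → ℝ) (hg : Measurable g) (hh : Measurable h)
    (Cg : ℝ) (hCg : ∀ θ, |g θ| ≤ Cg) (Ch : ℝ) (hCh : ∀ θ, |h θ| ≤ Ch) :
    (∫ θ, g θ ∂(Gibbs π (fun θ => -g θ))) - (∫ θ, g θ ∂(Gibbs π (fun θ => -h θ)))
      ≤ (∫ θ, h θ ∂(Gibbs π (fun θ => -g θ))) - (∫ θ, h θ ∂(Gibbs π (fun θ => -h θ))) := by
  have ig := integrable_exp_neg_sub_const π hg hCg
  have ih := integrable_exp_neg_sub_const π hh hCh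
  have ig₀ : Integrable (fun θ => Real.exp (-g θ)) π := by simpa using ig 0
  have ih₀ : Integrable (fun θ => Real.exp (-h θ)) π := by simpa using ih 0
  have hp := integral_exp_sub_log_integral π ig₀
  have hq := integral_exp_sub_log_integral π ih₀
  rw [integral_Gibbs π (by fun_prop) ig₀, integral_Gibbs π (by fun_prop) ig₀,
    integral_Gibbs π (by fun_prop) ih₀, integral_Gibbs π (by fun_prop) ih₀]
  set u := Real.log (∫ ω, Real.exp (-g ω) ∂π)
  set v := Real.log (∫ ω, Real.exp (-h ω) ∂π)
  have igg := (ig u).mul_bdd (c := Cg) hg.aestronglyMeasurable (.of_forall hCg)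
  have igh := (ig u).mul_bdd (c := Ch) hh.aestronglyMeasurable (.of_forall hCh)
  have ihg := (ih v).mul_bdd (c := Cg) hg.aestronglyMeasurable (.of_forall hCg)
  have ihh := (ih v).mul_bdd (c := Ch) hh.aestronglyMeasurable (.of_forall hCh)
  have key : 0 ≤ ∫ θ, (((Real.exp (-g θ - u) * h θ - Real.exp (-h θ - v) * h θ)
      - (Real.exp (-g θ - u) * g θ - Real.exp (-h θ - v) * g θ))
      + (v - u) * (Real.exp (-g θ - u) - Real.exp (-h θ - v))) ∂π := by
    refine integral_nonneg fun θ => ?_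
    have := exp_sub_exp_mul_sub_nonneg (-g θ - u) (-h θ - v)
    simp only [Pi.zero_apply]
    linarith
  have ip := ig u
  have iq := ih v
  rw [integral_add (by fun_prop) (by fun_prop), integral_sub (by fun_prop) (by fun_prop),
    integral_sub igh ihh, integral_sub igg ihg, integral_const_mul, integral_sub ip iq,
    hp, hq] at key
  linarith
end
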